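/- arXiv:2312.16666 — 2 statements merged into one kernel-verified Lean document; each statement's English description precedes it below -/
import Mathlib

section
/- Let p be a core (I,J)-coset and let s ∈ S∖J satisfy ℓ(p̄·s) < ℓ(p̄). Then there exist m ≥ 1 and a reduced atomic expression (L_0,…,L_m; s_1,…,s_m) from I to J with last removed letter t_m = s and with x_m = p̄, i.e. expressing p. -/
namespace CoxeterAtoms

variable {B : Type*} {W : Type*} [Group W] {M : CoxeterMatrix B}

/-- The standard parabolic subgroup `W_K` generated by the simple reflections indexed by `K`. -/
def par (cs : CoxeterSystem M W) (K : Set B) : Subgroup W :=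
  Subgroup.closure (cs.simple '' K)

/-- `K` is finitary if `W_K` is finite. -/
def Finitary (cs : CoxeterSystem M W) (K : Set B) : Prop :=
  ((par cs K : Set W)).Finite

/-- The left coset `W_I · x`. -/
def lcos (cs : CoxeterSystem M W) (I : Set B) (x : W) : Set W :=
  {w | ∃ a ∈ par cs I, w = a * x}

/-- The right coset `x · W_J`. -/
def rcos (cs : CoxeterSystem M W) (x : W) (J : Set B) : Set W :=
  {w | ∃ b ∈ par cs J, w = x * b}

/-- The double coset `W_I · x · W_J`. -/
def dcos (cs : CoxeterSystem M W) (I : Set B) (x : W) (J : Set B) : Set W :=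
  {w | ∃ a ∈ par cs I, ∃ b ∈ par cs J, w = a * x * b}

/-- `x` is a minimal length element of its double coset `W_I · x · W_J`. -/
def IsMinRep (cs : CoxeterSystem M W) (I : Set B) (x : W) (J : Set B) : Prop :=
  ∀ w ∈ dcos cs I x J, cs.length x ≤ cs.length w

/-- `y` is a maximal length element of the set `p`. -/
def IsMaxOf (cs : CoxeterSystem M W) (p : Set W) (y : W) : Prop :=
  y ∈ p ∧ ∀ w ∈ p, cs.length w ≤ cs.length y

/-- `y` is the longest element of the standard parabolic subgroup `W_K`. -/
def IsLongest (cs : CoxeterSystem M W) (K : Set B) (y : W) : Prop :=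
  y ∈ par cs K ∧ ∀ w ∈ par cs K, cs.length w ≤ cs.length y

/-- The double coset `W_I · x · W_J` is core: `W_I·x = W_I·x·W_J = x·W_J`. -/
def IsCore (cs : CoxeterSystem M W) (I : Set B) (x : W) (J : Set B) : Prop :=
  lcos cs I x = dcos cs I x J ∧ dcos cs I x J = rcos cs x J

/-- A reduced atomic expression `(L_0,…,L_m; s_1,…,s_m)` of width `m` from `I` to `J`,
together with the associated data: the removed letters `t_i`, the longest elements
`w_{L_i}` and `w_{K_i}` (where `K_i = L_{i-1} ∪ {s_i}`), and the partial products `x_i`. -/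
structure RAtomExpr (cs : CoxeterSystem M W) (I J : Set B) (m : ℕ) where
  Lset : ℕ → Set B
  letter : ℕ → B
  tletter : ℕ → B
  wL : ℕ → W
  wK : ℕ → W
  x : ℕ → W
  hL0 : Lset 0 = I
  hLm : Lset m = J
  hwL : ∀ i ≤ m, IsLongest cs (Lset i) (wL i)
  hmem : ∀ i, 1 ≤ i → i ≤ m → letter i ∉ Lset (i - 1)
  hfinK : ∀ i, 1 ≤ i → i ≤ m → Finitary cs (Lset (i - 1) ∪ {letter i})
  hwK : ∀ i, 1 ≤ i → i ≤ m → IsLongest cs (Lset (i - 1) ∪ {letter i}) (wK i)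
  ht : ∀ i, 1 ≤ i → i ≤ m →
    cs.simple (tletter i) = wK i * cs.simple (letter i) * wK i
  hLi : ∀ i, 1 ≤ i → i ≤ m → Lset i = (Lset (i - 1) ∪ {letter i}) \ {tletter i}
  hx0 : x 0 = wL 0
  hx : ∀ i, 1 ≤ i → i ≤ m → x i = x (i - 1) * wL (i - 1) * wK i
  hred : ∀ i, 1 ≤ i → i ≤ m →
    (cs.length (x i) : ℤ) =
      (cs.length (x (i - 1)) : ℤ) - cs.length (wL (i - 1)) + cs.length (wK i)

/-! ### Injectivity of the simple reflections -/

open Polynomial.Chebyshev in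
theorem cheb_zero (m k : ℕ) (hm : m = 2 * k + 1) (hk : 1 ≤ k) :
    (S ℝ (k : ℤ)).eval (2 * Real.cos (2 * Real.pi / m)) +
      (S ℝ ((k : ℤ) - 1)).eval (2 * Real.cos (2 * Real.pi / m)) = 0 := by
  set θ : ℝ := 2 * Real.pi / m with hθ
  have hmpos : (0 : ℝ) < m := by rw [hm]; positivity
  have hm3 : (3 : ℝ) ≤ m := by rw [hm]; exact_mod_cast (by omega : 3 ≤ 2 * k + 1)
  have hs : Real.sin θ ≠ 0 := by
    apply ne_of_gt
    apply Real.sin_pos_of_pos_of_lt_pi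
    · rw [hθ]; positivity
    · rw [hθ, div_lt_iff₀ hmpos]
      nlinarith [Real.pi_pos]
  apply mul_right_cancel₀ hs
  rw [add_mul, S_two_mul_real_cos, S_two_mul_real_cos, zero_mul]
  have e1 : (((k : ℤ) : ℝ) + 1) * θ = 2 * Real.pi - k * θ := by
    have : (m : ℝ) * θ = 2 * Real.pi := by rw [hθ]; field_simp
    rw [hm] at this
    push_cast at this ⊢
    linarith
  have e2 : ((((k : ℤ) - 1 : ℤ) : ℝ) + 1) * θ = k * θ := by push_cast; ring
  rw [e1, e2, Real.sin_two_pi_sub]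
  ring

/-- Coefficients of a reflection representation. -/
noncomputable def coef (M : CoxeterMatrix B) (i j : B) : ℝ :=
  open Classical in if Odd (M i j) then -2 * Real.cos (Real.pi / (M i j : ℝ)) else 0

theorem coef_self (M : CoxeterMatrix B) (i : B) : coef M i i = 2 := by
  simp [coef]

theorem coef_comm (M : CoxeterMatrix B) (i j : B) : coef M i j = coef M j i := by
  simp [coef, M.symmetric i j]

/-- The coroot functional. -/
noncomputable def coroot (M : CoxeterMatrix B) (i : B) : Module.Dual ℝ (B →₀ ℝ) :=
  Finsupp.linearCombination ℝ (coef M i)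

theorem coroot_single (M : CoxeterMatrix B) (i j : B) :
    coroot M i (Finsupp.single j 1) = coef M i j := by
  simp [coroot, Finsupp.linearCombination_single]

theorem coroot_self (M : CoxeterMatrix B) (i : B) :
    coroot M i (Finsupp.single i 1) = 2 := by
  rw [coroot_single, coef_self]

/-- The geometric reflections. -/
noncomputable def geom (M : CoxeterMatrix B) (i : B) : (B →₀ ℝ) ≃ₗ[ℝ] (B →₀ ℝ) :=
  Module.reflection (coroot_self M i)

theorem geom_liftable (M : CoxeterMatrix B) : M.IsLiftable (geom M) := by
  intro i j
  by_cases hij : i = j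
  · subst hij
    simp only [CoxeterMatrix.diagonal, pow_one]
    apply LinearEquiv.ext
    intro z
    exact Module.involutive_reflection (coroot_self M i) z
  by_cases hodd : Odd (M i j)
  · obtain ⟨k, hk⟩ := hodd
    have hk1 : 1 ≤ k := by
      have := M.off_diagonal i j hij
      omega
    have hc := cheb_zero (M i j) k hk hk1
    have ht : 2 * Real.cos (2 * Real.pi / (M i j : ℝ)) =
        coroot M i (Finsupp.single j 1) * coroot M j (Finsupp.single i 1) - 2 := by
      rw [coroot_single, coroot_single, coef_comm M j i, coef, if_pos ⟨k, hk⟩]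
      rw [show 2 * Real.pi / (M i j : ℝ) = 2 * (Real.pi / (M i j : ℝ)) by ring, Real.cos_two_mul]
      ring
    apply LinearEquiv.ext
    intro z
    have := Module.reflection_mul_reflection_pow_apply (coroot_self M i) (coroot_self M j)
      (M i j) z _ ht
    rw [geom, geom, this]
    have a1 : ((M i j : ℤ) - 1) / 2 = k := by omega
    have a2 : ((M i j : ℤ) - 3) / 2 = k - 1 := by omega
    have a3 : ((M i j : ℤ)) / 2 = k := by omega
    have a4 : ((M i j : ℤ) - 2) / 2 = k - 1 := by omega
    rw [a1, a2, a3, a4, hc]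
    simp
  · have hev : Even (M i j) := Nat.not_odd_iff_even.mp hodd
    obtain ⟨k, hk⟩ := hev
    have c1 : coroot M i (Finsupp.single j 1) = 0 := by
      rw [coroot_single, coef, if_neg hodd]
    have c2 : coroot M j (Finsupp.single i 1) = 0 := by
      rw [coroot_single, coef_comm, coef, if_neg hodd]
    have h2 : (geom M i * geom M j) ^ 2 = 1 := by
      apply LinearEquiv.ext
      intro z
      simp only [geom, pow_two, LinearEquiv.mul_apply, Module.reflection_apply, map_sub, map_smul,
        c1, c2, coroot_self, LinearEquiv.coe_one, id]
      module
    rw [hk, ← two_mul, pow_mul, h2, one_pow]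

theorem simple_inj (cs : CoxeterSystem M W) {i j : B} (h : cs.simple i = cs.simple j) : i = j := by
  by_contra hij
  have h1 := congrArg (cs.lift ⟨geom M, geom_liftable M⟩) h
  rw [cs.lift_apply_simple, cs.lift_apply_simple] at h1
  have h2 := congrArg (fun e => e (Finsupp.single i (1 : ℝ)) i) h1
  simp only [geom, Module.reflection_apply, coroot_self] at h2
  rw [coroot_single] at h2
  have hij' : ¬ j = i := fun h => hij h.symm
  simp [hij'] at h2

/-! ### The exchange condition -/

open Classical in
/-- The generator of the parity action. -/
noncomputable def act (cs : CoxeterSystem M W) (i : B) : Function.End (W × ZMod 2) :=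
  fun p => (cs.simple i * p.1 * cs.simple i, p.2 + if p.1 = cs.simple i then 1 else 0)

open Classical in
theorem act_pow (cs : CoxeterSystem M W) (i j : B) (n : ℕ) (p : W × ZMod 2) :
    ((act cs i * act cs j) ^ n) p =
      ((cs.simple i * cs.simple j) ^ n * p.1 * ((cs.simple i * cs.simple j) ^ n)⁻¹,
        p.2 + ∑ l ∈ Finset.range (2 * n),
          if p.1 = ((cs.simple i * cs.simple j) ^ l)⁻¹ * cs.simple j then (1 : ZMod 2) else 0) := by
  induction n with
  | zero => simp; rfl
  | succ n ih =>
    rw [pow_succ']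
    change act cs i (act cs j (((act cs i * act cs j) ^ n) p)) = _
    rw [ih]
    set r := cs.simple i * cs.simple j with hr
    have hjr : cs.simple j * r = r⁻¹ * cs.simple j := by
      rw [hr]; simp [mul_assoc]
    have hjrn : ∀ k : ℕ, cs.simple j * r ^ k = (r ^ k)⁻¹ * cs.simple j := by
      intro k
      induction k with
      | zero => simp
      | succ k ihk =>
        rw [pow_succ' r k, ← mul_assoc, hjr, mul_assoc, ihk, ← pow_succ' r k, pow_succ r k,
          mul_inv_rev (r ^ k) r, mul_assoc]
    have hji : cs.simple j * cs.simple i * cs.simple j = r⁻¹ * cs.simple j := by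
      rw [hr]; simp [mul_assoc]
    apply Prod.ext
    · simp only [act]
      rw [pow_succ' r, mul_inv_rev]
      have : r⁻¹ = cs.simple j * cs.simple i := by rw [hr]; simp
      rw [this, hr]
      simp only [mul_assoc]
    · simp only [act]
      rw [show 2 * (n + 1) = 2 * n + 1 + 1 by ring, Finset.sum_range_succ, Finset.sum_range_succ]
      have e1 : (r ^ n * p.1 * (r ^ n)⁻¹ = cs.simple j) ↔ p.1 = (r ^ (2 * n))⁻¹ * cs.simple j := by
        rw [two_mul, pow_add, mul_inv_rev, mul_assoc _ _ (cs.simple j), ← hjrn, mul_inv_eq_iff_eq_mul,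
          eq_inv_mul_iff_mul_eq]
      have e2 : (cs.simple j * (r ^ n * p.1 * (r ^ n)⁻¹) * cs.simple j = cs.simple i) ↔
          p.1 = (r ^ (2 * n + 1))⁻¹ * cs.simple j := by
        have : (cs.simple j * (r ^ n * p.1 * (r ^ n)⁻¹) * cs.simple j = cs.simple i) ↔
            r ^ n * p.1 * (r ^ n)⁻¹ = cs.simple j * cs.simple i * cs.simple j := by
          constructor
          · intro h; rw [← h]; simp [mul_assoc]
          · intro h; rw [h]; simp [mul_assoc]
        rw [this, hji, mul_inv_eq_iff_eq_mul, mul_assoc, hjrn, ← eq_inv_mul_iff_mul_eq]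
        have : (r ^ (2 * n + 1))⁻¹ * cs.simple j =
            (r ^ n)⁻¹ * (r⁻¹ * ((r ^ n)⁻¹ * cs.simple j)) := by
          rw [show 2 * n + 1 = n + 1 + n by ring, pow_add, pow_add, pow_one]
          simp only [mul_inv_rev, mul_assoc]
        rw [this]
      simp only [e1, e2]
      ring

open Classical in
theorem sum_double (r t q : W) (m : ℕ) (h : r ^ m = 1) :
    ∑ l ∈ Finset.range (2 * m), (if t = (r ^ l)⁻¹ * q then (1 : ZMod 2) else 0) = 0 := by
  rw [two_mul, Finset.sum_range_add]
  simp only [pow_add, h, one_mul]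
  exact CharTwo.add_self_eq_zero _

theorem act_liftable (cs : CoxeterSystem M W) : M.IsLiftable (act cs) := by
  intro i j
  funext p
  have h1 := cs.simple_mul_simple_pow i j
  refine (act_pow cs i j _ p).trans ?_
  refine Prod.ext ?_ ?_
  · change _ = p.1
    simp only [h1]
    simp
  · change _ = p.2
    simp only [sum_double _ _ _ _ h1, add_zero]

/-- The parity action. -/
noncomputable def actHom (cs : CoxeterSystem M W) : W →* Function.End (W × ZMod 2) :=
  cs.lift ⟨act cs, act_liftable cs⟩

open Classical in
theorem actHom_word (cs : CoxeterSystem M W) (ω : List B) (p : W × ZMod 2) :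
    actHom cs (cs.wordProd ω) p =
      (cs.wordProd ω * p.1 * (cs.wordProd ω)⁻¹,
        p.2 + ((cs.rightInvSeq ω).count p.1 : ZMod 2)) := by
  induction ω with
  | nil => simp [Function.End.one_def]
  | cons i ω ih =>
    rw [cs.wordProd_cons, map_mul]
    change actHom cs (cs.simple i) (actHom cs (cs.wordProd ω) p) = _
    rw [ih, actHom, cs.lift_apply_simple]
    apply Prod.ext
    · simp [act, mul_assoc]
    · simp only [act, CoxeterSystem.rightInvSeq, List.count_cons, beq_iff_eq]
      have : (cs.wordProd ω * p.1 * (cs.wordProd ω)⁻¹ = cs.simple i) ↔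
          ((cs.wordProd ω)⁻¹ * cs.simple i * cs.wordProd ω = p.1) := by
        constructor
        · intro h; rw [← h]; group
        · intro h; rw [← h]; group
      simp only [this]
      push_cast
      ring

theorem exchange (cs : CoxeterSystem M W) (ω : List B) (i : B)
    (h : cs.length (cs.wordProd ω * cs.simple i) < cs.length (cs.wordProd ω)) :
    ∃ j < ω.length, cs.wordProd ω * cs.simple i = cs.wordProd (ω.eraseIdx j) := by
  classical
  obtain ⟨ω', hred, hω'⟩ := cs.exists_isReduced (cs.wordProd ω * cs.simple i)
  have hw : cs.wordProd ω = cs.wordProd (ω'.concat i) := by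
    rw [cs.wordProd_concat, ← hω']; simp
  have hnot : cs.simple i ∉ cs.rightInvSeq ω' := by
    intro hmem
    have := (cs.isRightInversion_of_mem_rightInvSeq hred hmem).2
    rw [← hω'] at this
    simp only [CoxeterSystem.simple_mul_simple_cancel_right] at this
    omega
  have h1 := actHom_word cs ω (cs.simple i, 0)
  rw [hw, actHom_word cs (ω'.concat i)] at h1
  have h2 := congrArg Prod.snd h1
  simp only [cs.rightInvSeq_concat, zero_add] at h2
  have hc : (List.map (MulAut.conj (cs.simple i)) (cs.rightInvSeq ω')).count (cs.simple i) = 0 := by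
    rw [List.count_eq_zero]
    intro hmem
    obtain ⟨t, ht, hte⟩ := List.mem_map.mp hmem
    apply hnot
    have : t = cs.simple i := by
      rw [MulAut.conj_apply] at hte
      have := mul_inv_eq_iff_eq_mul.mp hte
      exact mul_left_cancel this
    rwa [this] at ht
  rw [List.concat_eq_append, List.count_append, hc] at h2
  have hmem : cs.simple i ∈ cs.rightInvSeq ω := by
    by_contra hn
    rw [List.count_eq_zero.mpr hn] at h2
    simp at h2
  obtain ⟨j, hj, hje⟩ := List.mem_iff_getElem.mp hmem
  refine ⟨j, by simpa using hj, ?_⟩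
  rw [← cs.wordProd_mul_getD_rightInvSeq, List.getD_eq_getElem _ 1 hj, hje]

/-! ### Parabolic subgroups -/

theorem simple_mem_par (cs : CoxeterSystem M W) {K : Set B} {i : B} (hi : i ∈ K) :
    cs.simple i ∈ par cs K :=
  Subgroup.subset_closure ⟨i, hi, rfl⟩

theorem wordProd_mem_par (cs : CoxeterSystem M W) {K : Set B} {ω : List B}
    (h : ∀ i ∈ ω, i ∈ K) : cs.wordProd ω ∈ par cs K := by
  induction ω with
  | nil => simpa using (par cs K).one_mem
  | cons i ω ih =>
    rw [cs.wordProd_cons]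
    exact (par cs K).mul_mem (simple_mem_par cs (h i (by simp)))
      (ih fun j hj => h j (by simp [hj]))

theorem exists_reduced_in (cs : CoxeterSystem M W) {K : Set B} {w : W} (hw : w ∈ par cs K) :
    ∃ ω : List B, (∀ i ∈ ω, i ∈ K) ∧ cs.IsReduced ω ∧ cs.wordProd ω = w := by
  have step : ∀ (x y : W), y ∈ cs.simple '' K →
      (∃ ω : List B, (∀ i ∈ ω, i ∈ K) ∧ cs.IsReduced ω ∧ cs.wordProd ω = x) →
      (∃ ω : List B, (∀ i ∈ ω, i ∈ K) ∧ cs.IsReduced ω ∧ cs.wordProd ω = x * y) := by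
    rintro x y ⟨i, hi, rfl⟩ ⟨ω, hK, hred, rfl⟩
    rcases cs.length_mul_simple (cs.wordProd ω) i with h | h
    · refine ⟨ω.concat i, ?_, ?_, cs.wordProd_concat i ω⟩
      · intro j hj
        rw [List.concat_eq_append, List.mem_append, List.mem_singleton] at hj
        rcases hj with hj | rfl
        · exact hK j hj
        · exact hi
      · unfold CoxeterSystem.IsReduced
        rw [cs.wordProd_concat, h, hred.eq]
        simp
    · obtain ⟨j, hj, he⟩ := exchange cs ω i (by omega)
      refine ⟨ω.eraseIdx j, ?_, ?_, he.symm⟩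
      · intro k hk
        exact hK k (List.mem_of_mem_eraseIdx hk)
      · unfold CoxeterSystem.IsReduced
        rw [← he]
        have := List.length_eraseIdx_add_one hj
        have := hred.eq
        omega
  induction hw using Subgroup.closure_induction_right with
  | one => exact ⟨[], by simp, by simp [CoxeterSystem.IsReduced], by simp⟩
  | mul_right x hx y hy ih => exact step x y hy ih
  | mul_inv_cancel x hx y hy ih =>
    have : y⁻¹ = y := by
      obtain ⟨i, hi, rfl⟩ := hy
      exact cs.inv_simple i
    rw [this]
    exact step x y hy ih

theorem mem_of_simple_mem_par (cs : CoxeterSystem M W) {K : Set B} {i : B}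
    (h : cs.simple i ∈ par cs K) : i ∈ K := by
  obtain ⟨ω, hK, hred, he⟩ := exists_reduced_in cs h
  have hl : ω.length = 1 := by rw [← hred.eq, he, cs.length_simple]
  obtain ⟨k, rfl⟩ := List.length_eq_one_iff.mp hl
  rw [cs.wordProd_singleton] at he
  rw [← simple_inj cs he]
  exact hK k (by simp)

theorem par_inj (cs : CoxeterSystem M W) {K L : Set B} (h : par cs K = par cs L) : K = L := by
  ext i
  exact ⟨fun hi => mem_of_simple_mem_par cs (h ▸ simple_mem_par cs hi),
    fun hi => mem_of_simple_mem_par cs (h ▸ simple_mem_par cs hi)⟩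

/-- Induction on elements of a parabolic subgroup along reduced words. -/
theorem par_induction (cs : CoxeterSystem M W) {K : Set B} {P : W → Prop} (one : P 1)
    (step : ∀ (ω : List B) (i : B), (∀ k ∈ ω, k ∈ K) → i ∈ K → cs.IsReduced ω →
      cs.length (cs.wordProd ω * cs.simple i) = ω.length + 1 → P (cs.wordProd ω) →
      P (cs.wordProd ω * cs.simple i)) {u : W} (hu : u ∈ par cs K) : P u := by
  obtain ⟨ω, hK, hred, rfl⟩ := exists_reduced_in cs hu
  clear hu
  induction ω using List.reverseRecOn with
  | nil => simpa using one
  | append_singleton ω i ih =>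
    have hred' : cs.IsReduced ω := by
      have := hred.take ω.length
      simpa using this
    have hKω : ∀ k ∈ ω, k ∈ K := fun k hk => hK k (by simp [hk])
    have hl := hred.eq
    rw [cs.wordProd_append, cs.wordProd_singleton] at hl ⊢
    exact step ω i hKω (hK i (by simp)) hred' (by simpa using hl) (ih hKω hred')

/-- Exchange for a product of two words. -/
theorem exchange_mul (cs : CoxeterSystem M W) (z : W) (ω : List B) (i : B)
    (h : cs.length (z * cs.wordProd ω * cs.simple i) < cs.length (z * cs.wordProd ω)) :
    (∃ z', cs.length z' < cs.length z ∧
      z * cs.wordProd ω * cs.simple i = z' * cs.wordProd ω) ∨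
    (∃ j < ω.length, cs.wordProd ω * cs.simple i = cs.wordProd (ω.eraseIdx j)) := by
  obtain ⟨ζ, hred, rfl⟩ := cs.exists_isReduced z
  rw [← cs.wordProd_append] at h
  obtain ⟨j, hj, he⟩ := exchange cs (ζ ++ ω) i h
  rw [List.length_append] at hj
  rw [cs.wordProd_append] at he
  by_cases hjz : j < ζ.length
  · left
    rw [List.eraseIdx_append_of_lt_length hjz, cs.wordProd_append] at he
    refine ⟨_, ?_, he⟩
    have h1 := cs.length_wordProd_le (ζ.eraseIdx j)
    have h2 := List.length_eraseIdx_add_one hjz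
    have := hred.eq
    omega
  · right
    rw [List.eraseIdx_append_of_length_le (by omega), cs.wordProd_append, mul_assoc] at he
    exact ⟨j - ζ.length, by omega, mul_left_cancel he⟩

theorem length_add_of_min (cs : CoxeterSystem M W) {K : Set B} {z : W}
    (hz : ∀ u ∈ par cs K, cs.length z ≤ cs.length (z * u)) {u : W} (hu : u ∈ par cs K) :
    cs.length (z * u) = cs.length z + cs.length u := by
  refine par_induction cs (P := fun u => cs.length (z * u) = cs.length z + cs.length u)
    (by simp) ?_ hu
  intro ω i hK hi hred hlen ih
  have hred := hred.eq
  rw [hlen, ← mul_assoc]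
  rcases cs.length_mul_simple (z * cs.wordProd ω) i with h | h
  · omega
  · exfalso
    rcases exchange_mul cs z ω i (by omega) with ⟨z', hz', he⟩ | ⟨j, hj, he⟩
    · have hP := wordProd_mem_par cs hK
      have := hz (cs.wordProd ω * cs.simple i * (cs.wordProd ω)⁻¹)
        ((par cs K).mul_mem ((par cs K).mul_mem hP (simple_mem_par cs hi))
          ((par cs K).inv_mem hP))
      rw [← mul_assoc, ← mul_assoc, he, mul_inv_cancel_right] at this
      omega
    · rw [he] at hlen
      have h1 := cs.length_wordProd_le (ω.eraseIdx j)
      have h2 := List.length_eraseIdx_add_one hj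
      omega

theorem exists_min_factor (cs : CoxeterSystem M W) (K : Set B) (w : W) :
    ∃ z v : W, v ∈ par cs K ∧ w = z * v ∧
      ∀ u ∈ par cs K, cs.length (z * u) = cs.length z + cs.length u := by
  classical
  have hex : ∃ n : ℕ, ∃ v ∈ par cs K, cs.length (w * v) = n := ⟨_, 1, (par cs K).one_mem, rfl⟩
  obtain ⟨v, hv, hvn⟩ := Nat.find_spec hex
  refine ⟨w * v, v⁻¹, (par cs K).inv_mem hv, by simp, ?_⟩
  intro u hu
  refine length_add_of_min cs ?_ hu
  intro u hu
  rw [hvn]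
  exact Nat.find_min' hex ⟨v * u, (par cs K).mul_mem hv hu, by rw [mul_assoc]⟩

theorem length_sub_of_desc (cs : CoxeterSystem M W) {K : Set B} {v : W}
    (hv : ∀ i ∈ K, cs.length (v * cs.simple i) < cs.length v) {u : W} (hu : u ∈ par cs K) :
    cs.length (v * u) + cs.length u = cs.length v := by
  suffices H : ∀ u ∈ par cs K, cs.length (v * u⁻¹) + cs.length u = cs.length v by
    have := H u⁻¹ ((par cs K).inv_mem hu)
    rwa [inv_inv, cs.length_inv] at this
  intro u hu
  refine par_induction cs (P := fun u => cs.length (v * u⁻¹) + cs.length u = cs.length v)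
    (by simp) ?_ hu
  intro ω i hK hi hred hlen ih
  have hred := hred.eq
  have hva : v = v * (cs.wordProd ω)⁻¹ * cs.wordProd ω := by group
  have hd := hv i hi
  rcases exchange_mul cs (v * (cs.wordProd ω)⁻¹) ω i (by rwa [← hva]) with
    ⟨z', hz', he⟩ | ⟨j, hj, he⟩
  · rw [← hva] at he
    have hz : v * (cs.wordProd ω * cs.simple i)⁻¹ = z' := by
      rw [mul_inv_rev, cs.inv_simple, ← mul_assoc, he, mul_inv_cancel_right]
    rw [hz]
    have hz2 : v = z' * (cs.wordProd ω * cs.simple i) := by rw [← hz]; group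
    have h3 := cs.length_mul_le z' (cs.wordProd ω * cs.simple i)
    rw [← hz2] at h3
    omega
  · exfalso
    rw [he] at hlen
    have h1 := cs.length_wordProd_le (ω.eraseIdx j)
    have h2 := List.length_eraseIdx_add_one hj
    omega

theorem isLongest_of_desc (cs : CoxeterSystem M W) {K : Set B} {v : W} (hvK : v ∈ par cs K)
    (hv : ∀ i ∈ K, cs.length (v * cs.simple i) < cs.length v) : IsLongest cs K v := by
  refine ⟨hvK, fun w hw => ?_⟩
  have := length_sub_of_desc cs hv hw
  omega

theorem IsLongest.desc {cs : CoxeterSystem M W} {K : Set B} {v : W} (h : IsLongest cs K v) :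
    ∀ i ∈ K, cs.length (v * cs.simple i) < cs.length v := by
  intro i hi
  have h1 := h.2 _ ((par cs K).mul_mem h.1 (simple_mem_par cs hi))
  have h2 := cs.length_mul_simple_ne v i
  omega

theorem IsLongest.length_sub {cs : CoxeterSystem M W} {K : Set B} {v : W} (h : IsLongest cs K v)
    {u : W} (hu : u ∈ par cs K) : cs.length (v * u) + cs.length u = cs.length v :=
  length_sub_of_desc cs h.desc hu

theorem IsLongest.mul_self {cs : CoxeterSystem M W} {K : Set B} {v : W} (h : IsLongest cs K v) :
    v * v = 1 := by
  have := h.length_sub h.1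
  exact cs.length_eq_zero_iff.mp (by omega)

theorem IsLongest.inv {cs : CoxeterSystem M W} {K : Set B} {v : W} (h : IsLongest cs K v) :
    v⁻¹ = v := inv_eq_of_mul_eq_one_left h.mul_self

theorem IsLongest.unique {cs : CoxeterSystem M W} {K : Set B} {v v' : W} (h : IsLongest cs K v)
    (h' : IsLongest cs K v') : v = v' := by
  have h1 := h.length_sub h'.1
  have h2 := h'.2 v h.1
  have h3 : v * v' = 1 := cs.length_eq_zero_iff.mp (by omega)
  rw [← h'.inv]
  exact eq_inv_of_mul_eq_one_left h3

theorem IsLongest.conj_simple {cs : CoxeterSystem M W} {K : Set B} {v : W}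
    (h : IsLongest cs K v) {i : B} (hi : i ∈ K) :
    ∃ k ∈ K, v * cs.simple i * v = cs.simple k := by
  have hs := simple_mem_par cs hi
  have h1 := h.length_sub ((par cs K).mul_mem hs h.1)
  have h2 := h.length_sub hs
  have h3 : cs.length (cs.simple i * v) = cs.length (v * cs.simple i) := by
    rw [← cs.length_inv, mul_inv_rev, h.inv, cs.inv_simple]
  rw [cs.length_simple] at h2
  rw [← mul_assoc] at h1
  obtain ⟨k, hk⟩ := cs.length_eq_one_iff.mp (show cs.length (v * cs.simple i * v) = 1 by omega)
  refine ⟨k, ?_, hk⟩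
  apply mem_of_simple_mem_par cs
  rw [← hk]
  exact (par cs K).mul_mem ((par cs K).mul_mem h.1 hs) h.1

theorem par_mono (cs : CoxeterSystem M W) {K L : Set B} (h : K ⊆ L) : par cs K ≤ par cs L :=
  Subgroup.closure_mono (Set.image_mono h)

theorem exists_longest (cs : CoxeterSystem M W) {K : Set B} (h : Finitary cs K) :
    ∃ v, IsLongest cs K v := by
  obtain ⟨v, hv, hm⟩ := Set.exists_max_image (par cs K : Set W) cs.length h
    ⟨1, (par cs K).one_mem⟩
  exact ⟨v, hv, hm⟩

theorem finite_of_desc (cs : CoxeterSystem M W) {K : Set B} {v : W}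
    (hv : ∀ i ∈ K, cs.length (v * cs.simple i) < cs.length v) : Finitary cs K := by
  classical
  -- `K` is finite
  have hKfin : K.Finite := by
    obtain ⟨ω, hred, rfl⟩ := cs.exists_isReduced v
    have himg : (cs.simple '' K).Finite := by
      apply Set.Finite.subset (Set.finite_range
        (fun j : Fin ω.length => (cs.wordProd ω)⁻¹ * cs.wordProd (ω.eraseIdx j)))
      rintro _ ⟨i, hi, rfl⟩
      obtain ⟨j, hj, he⟩ := exchange cs ω i (hv i hi)
      exact ⟨⟨j, hj⟩, by simp only; rw [← he]; group⟩
    exact himg.of_finite_image (fun i _ j _ hij => simple_inj cs hij)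
  have : Finite K := hKfin
  have hfin := List.finite_length_le K (cs.length v)
  apply (hfin.image (fun l => cs.wordProd (l.map Subtype.val))).subset
  intro u hu
  obtain ⟨ω, hK, hred, rfl⟩ := exists_reduced_in cs hu
  have hlen := length_sub_of_desc cs hv hu
  have := hred.eq
  refine ⟨ω.attach.map (fun x => ⟨x.1, hK x.1 x.2⟩), ?_, ?_⟩
  · simp only [Set.mem_setOf_eq, List.length_map, List.length_attach]
    omega
  · simp

/-! ### The induction -/

/-- `x` normalizes `W_J` to `W_I` and has all of `J` as right descents. -/
def Good (cs : CoxeterSystem M W) (I : Set B) (x : W) (J : Set B) : Prop :=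
  (∀ u, u ∈ par cs J ↔ x * u * x⁻¹ ∈ par cs I) ∧
    ∀ j ∈ J, cs.length (x * cs.simple j) < cs.length x

theorem good_step (cs : CoxeterSystem M W) {I J : Set B} {x : W} (hg : Good cs I x J) {s : B}
    (hsJ : s ∉ J) (hdes : cs.length (x * cs.simple s) < cs.length x) :
    ∃ (L : Set B) (k : B) (wL wK x' : W), k ∉ L ∧ Finitary cs (L ∪ {k}) ∧ IsLongest cs L wL ∧
      IsLongest cs (L ∪ {k}) wK ∧ cs.simple s = wK * cs.simple k * wK ∧
      J = (L ∪ {k}) \ {s} ∧ x = x' * wL * wK ∧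
      (cs.length x : ℤ) = (cs.length x' : ℤ) - cs.length wL + cs.length wK ∧
      Good cs I x' L ∧ cs.length x' < cs.length x := by
  obtain ⟨hconj, hdJ⟩ := hg
  set K : Set B := J ∪ {s} with hKdef
  have hdK : ∀ i ∈ K, cs.length (x * cs.simple i) < cs.length x := by
    rintro i (hi | hi)
    · exact hdJ i hi
    · rw [Set.mem_singleton_iff.mp hi]; exact hdes
  have hfin : Finitary cs K := finite_of_desc cs hdK
  obtain ⟨z, v, hv, rfl, hz⟩ := exists_min_factor cs K x
  have hvl : IsLongest cs K v := by
    apply isLongest_of_desc cs hv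
    intro i hi
    have h1 := hdK i hi
    rw [mul_assoc, hz _ hv, hz _ ((par cs K).mul_mem hv (simple_mem_par cs hi))] at h1
    omega
  have hsK : s ∈ K := Or.inr rfl
  obtain ⟨k, hkK, hk⟩ := hvl.conj_simple hsK
  have hvv := hvl.mul_self
  have hkback : cs.simple s = v * cs.simple k * v := by
    rw [← hk]
    calc cs.simple s = (v * v) * cs.simple s * (v * v) := by rw [hvv]; simp
      _ = _ := by simp only [mul_assoc]
  set L : Set B := K \ {k} with hL
  have hLk : L ∪ {k} = K := by
    rw [hL]; exact Set.diff_union_of_subset (Set.singleton_subset_iff.mpr hkK)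
  have hkL : k ∉ L := fun h => h.2 rfl
  have hLK : L ⊆ K := Set.diff_subset
  obtain ⟨wL, hwL⟩ := exists_longest cs (K := L) (hfin.subset (par_mono cs hLK))
  have hwLK : wL ∈ par cs K := par_mono cs hLK hwL.1
  have hJ : J = K \ {s} := by
    ext i
    constructor
    · intro hi
      exact ⟨Or.inl hi, fun h => hsJ (by rw [← Set.mem_singleton_iff.mp h]; exact hi)⟩
    · rintro ⟨hi | hi, hn⟩
      · exact hi
      · exact absurd hi hn
  -- conjugation by `v`
  have hLJ : ∀ u ∈ par cs L, v * u * v⁻¹ ∈ par cs J := by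
    have : par cs L ≤ (par cs J).comap (MulAut.conj v).toMonoidHom := by
      unfold par
      rw [Subgroup.closure_le]
      rintro _ ⟨l, hl, rfl⟩
      change v * cs.simple l * v⁻¹ ∈ par cs J
      obtain ⟨j, hj, hje⟩ := hvl.conj_simple (hLK hl)
      rw [hvl.inv, hje]
      apply simple_mem_par
      rw [hJ]
      refine ⟨hj, ?_⟩
      rintro rfl
      apply hkL
      have : cs.simple l = cs.simple k := by
        rw [← hk, ← hje]
        calc cs.simple l = (v * v) * cs.simple l * (v * v) := by rw [hvv]; simp
          _ = _ := by simp only [mul_assoc]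
      rw [← simple_inj cs this]; exact hl
    intro u hu
    exact this hu
  have hJL : ∀ u ∈ par cs J, v * u * v⁻¹ ∈ par cs L := by
    have : par cs J ≤ (par cs L).comap (MulAut.conj v).toMonoidHom := by
      unfold par
      rw [Subgroup.closure_le]
      rintro _ ⟨j, hj, rfl⟩
      change v * cs.simple j * v⁻¹ ∈ par cs L
      obtain ⟨l, hl, hle⟩ := hvl.conj_simple (show j ∈ K from Or.inl hj)
      rw [hvl.inv, hle]
      apply simple_mem_par
      refine ⟨hl, ?_⟩
      rintro rfl
      apply hsJ
      have : cs.simple j = cs.simple s := by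
        rw [hkback, ← hle]
        calc cs.simple j = (v * v) * cs.simple j * (v * v) := by rw [hvv]; simp
          _ = _ := by simp only [mul_assoc]
      rw [← simple_inj cs this]; exact hj
    intro u hu
    exact this hu
  have hlx := hz v hv
  have hlx' := hz wL hwLK
  refine ⟨L, k, wL, v, z * wL, hkL, by rwa [hLk], hwL, by rwa [hLk], hkback, by rwa [hLk],
    ?_, ?_, ⟨?_, ?_⟩, ?_⟩
  · rw [mul_assoc z, hwL.mul_self, mul_one]
  · rw [hlx, hlx']; push_cast; ring
  · intro u
    have e : z * wL * u * (z * wL)⁻¹ =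
        (z * v) * (v⁻¹ * (wL * u * wL⁻¹) * v) * (z * v)⁻¹ := by group
    rw [e, ← hconj]
    constructor
    · intro hu
      have h1 : wL * u * wL⁻¹ ∈ par cs L :=
        (par cs L).mul_mem ((par cs L).mul_mem hwL.1 hu) ((par cs L).inv_mem hwL.1)
      have := hLJ _ h1
      rwa [hvl.inv] at this ⊢
    · intro hu
      have h1 := hJL _ hu
      have e2 : v * (v⁻¹ * (wL * u * wL⁻¹) * v) * v⁻¹ = wL * u * wL⁻¹ := by group
      rw [e2] at h1
      have h2 := (par cs L).mul_mem ((par cs L).mul_mem ((par cs L).inv_mem hwL.1) h1) hwL.1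
      have e3 : wL⁻¹ * (wL * u * wL⁻¹) * wL = u := by group
      rwa [e3] at h2
  · intro l hl
    rw [mul_assoc, hlx', hz _ ((par cs K).mul_mem hwLK (simple_mem_par cs (hLK hl)))]
    have := hwL.desc l hl
    omega
  · rw [hlx, hlx']
    have h1 := hvl.length_sub hwLK
    have h2 : cs.length (v * wL) ≠ 0 := by
      intro h0
      have h3 := cs.length_eq_zero_iff.mp h0
      have h4 : v = wL := by rw [← hwL.inv]; exact eq_inv_of_mul_eq_one_left h3
      obtain ⟨ω, hωL, hred, he⟩ := exists_reduced_in cs (show v ∈ par cs L from h4 ▸ hwL.1)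
      obtain ⟨j, hj, hje⟩ := exchange cs ω k (by rw [he]; exact hvl.desc k hkK)
      apply hkL
      apply mem_of_simple_mem_par cs
      have h5 : cs.simple k = (cs.wordProd ω)⁻¹ * cs.wordProd (ω.eraseIdx j) := by
        rw [← hje]; group
      rw [h5]
      exact (par cs L).mul_mem ((par cs L).inv_mem (wordProd_mem_par cs hωL))
        (wordProd_mem_par cs fun i hi => hωL i (List.mem_of_mem_eraseIdx hi))
    omega

theorem good_base (cs : CoxeterSystem M W) {I J : Set B} {x : W} (hg : Good cs I x J)
    (hno : ∀ s, cs.length (x * cs.simple s) < cs.length x → s ∈ J) :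
    I = J ∧ IsLongest cs I x := by
  obtain ⟨hconj, hdJ⟩ := hg
  obtain ⟨z, v, hv, hx, hz⟩ := exists_min_factor cs I x⁻¹
  have hxe : x = v⁻¹ * z⁻¹ := by rw [← inv_inv x, hx, mul_inv_rev]
  have hlx : cs.length x = cs.length z + cs.length v := by
    rw [← cs.length_inv, hx, hz v hv]
  have hz1 : z⁻¹ = 1 := by
    by_contra hne
    obtain ⟨s, hs⟩ := cs.exists_rightDescent_of_ne_one hne
    unfold CoxeterSystem.IsRightDescent at hs
    have hsx : cs.length (x * cs.simple s) < cs.length x := by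
      have := cs.length_mul_le v⁻¹ (z⁻¹ * cs.simple s)
      rw [hxe, mul_assoc, ← hxe]
      rw [cs.length_inv] at hs this
      omega
    have hr := (hconj _).mp (simple_mem_par cs (hno s hsx))
    have h1 := hz _ ((par cs I).mul_mem ((par cs I).mul_mem hv hr) ((par cs I).inv_mem hv))
    have h2 : z * (v * (x * cs.simple s * x⁻¹) * v⁻¹) = (z⁻¹ * cs.simple s)⁻¹ := by
      rw [hxe, mul_inv_rev (z⁻¹), cs.inv_simple]; group
    rw [h2, cs.length_inv] at h1
    rw [cs.length_inv z] at hs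
    omega
  have hxI : x ∈ par cs I := by
    rw [hxe, hz1, mul_one]; exact (par cs I).inv_mem hv
  have hpar : par cs I = par cs J := by
    ext u
    rw [hconj u]
    constructor
    · intro hu
      exact (par cs I).mul_mem ((par cs I).mul_mem hxI hu) ((par cs I).inv_mem hxI)
    · intro hu
      have h2 := (par cs I).mul_mem ((par cs I).mul_mem ((par cs I).inv_mem hxI) hu) hxI
      have e3 : x⁻¹ * (x * u * x⁻¹) * x = u := by group
      rwa [e3] at h2
  have hIJ := par_inj cs hpar
  refine ⟨hIJ, isLongest_of_desc cs hxI ?_⟩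
  rw [hIJ]
  exact hdJ

theorem extend (cs : CoxeterSystem M W) {I J L : Set B} {m : ℕ} (E : RAtomExpr cs I L m)
    {k s : B} {wL wK x x' : W} (hEx : E.x m = x') (hkL : k ∉ L) (hfin : Finitary cs (L ∪ {k}))
    (hwL : IsLongest cs L wL) (hwK : IsLongest cs (L ∪ {k}) wK)
    (hs : cs.simple s = wK * cs.simple k * wK) (hJ : J = (L ∪ {k}) \ {s})
    (hx : x = x' * wL * wK)
    (hl : (cs.length x : ℤ) = (cs.length x' : ℤ) - cs.length wL + cs.length wK) :
    ∃ E' : RAtomExpr cs I J (m + 1), E'.tletter (m + 1) = s ∧ E'.x (m + 1) = x := by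
  have hJfin : Finitary cs J := by
    refine hfin.subset (par_mono cs ?_)
    rw [hJ]; exact Set.diff_subset
  obtain ⟨wJ, hwJ⟩ := exists_longest cs hJfin
  have hwLe : E.wL m = wL := by
    have := E.hwL m le_rfl
    rw [E.hLm] at this
    exact this.unique hwL
  have key : ∀ i, 1 ≤ i → i ≤ m + 1 → (i ≤ m ∧ i - 1 ≤ m ∧ i ≠ m + 1 ∧ i - 1 ≠ m + 1) ∨ i = m + 1 := by
    intro i _ _
    omega
  have hm1 : m ≠ m + 1 := by omega
  refine ⟨
    { Lset := fun i => if i = m + 1 then J else E.Lset i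
      letter := fun i => if i = m + 1 then k else E.letter i
      tletter := fun i => if i = m + 1 then s else E.tletter i
      wL := fun i => if i = m + 1 then wJ else E.wL i
      wK := fun i => if i = m + 1 then wK else E.wK i
      x := fun i => if i = m + 1 then x else E.x i
      hL0 := ?_, hLm := ?_, hwL := ?_, hmem := ?_, hfinK := ?_, hwK := ?_, ht := ?_,
      hLi := ?_, hx0 := ?_, hx := ?_, hred := ?_ }, ?_, ?_⟩
  · simpa using E.hL0
  · simp
  · intro i hi
    by_cases h : i = m + 1
    · simpa [h] using hwJ
    · simpa [h] using E.hwL i (by omega)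
  · intro i h1 h2
    rcases key i h1 h2 with ⟨h3, h4, h5, h6⟩ | rfl
    · simpa [h5, h6] using E.hmem i h1 h3
    · simpa [hm1, E.hLm] using hkL
  · intro i h1 h2
    rcases key i h1 h2 with ⟨h3, h4, h5, h6⟩ | rfl
    · simpa only [h5, h6, if_false] using E.hfinK i h1 h3
    · simpa only [Nat.add_sub_cancel, hm1, if_false, if_true, E.hLm] using hfin
  · intro i h1 h2
    rcases key i h1 h2 with ⟨h3, h4, h5, h6⟩ | rfl
    · simpa only [h5, h6, if_false] using E.hwK i h1 h3
    · simpa only [Nat.add_sub_cancel, hm1, if_false, if_true, E.hLm] using hwK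
  · intro i h1 h2
    rcases key i h1 h2 with ⟨h3, h4, h5, h6⟩ | rfl
    · simpa only [h5, h6, if_false] using E.ht i h1 h3
    · simpa only [if_true] using hs
  · intro i h1 h2
    rcases key i h1 h2 with ⟨h3, h4, h5, h6⟩ | rfl
    · simpa only [h5, h6, if_false] using E.hLi i h1 h3
    · simpa only [Nat.add_sub_cancel, hm1, if_false, if_true, E.hLm] using hJ
  · simpa using E.hx0
  · intro i h1 h2
    rcases key i h1 h2 with ⟨h3, h4, h5, h6⟩ | rfl
    · simpa only [h5, h6, if_false] using E.hx i h1 h3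
    · simpa only [Nat.add_sub_cancel, hm1, if_false, if_true, hEx, hwLe] using hx
  · intro i h1 h2
    rcases key i h1 h2 with ⟨h3, h4, h5, h6⟩ | rfl
    · simpa only [h5, h6, if_false] using E.hred i h1 h3
    · simpa only [Nat.add_sub_cancel, hm1, if_false, if_true, hEx, hwLe] using hl
  · simp
  · simp

theorem exists_expr (cs : CoxeterSystem M W) (b : B) (I : Set B) (n : ℕ) :
    ∀ (x : W) (J : Set B), cs.length x = n → Good cs I x J →
      ∃ m : ℕ, ∃ E : RAtomExpr cs I J m, E.x m = x := by
  induction n using Nat.strong_induction_on with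
  | _ n ih =>
    intro x J hn hg
    by_cases hd : ∃ s, s ∉ J ∧ cs.length (x * cs.simple s) < cs.length x
    · obtain ⟨s, hsJ, hdes⟩ := hd
      obtain ⟨L, k, wL, wK, x', hkL, hfin, hwL, hwK, hs, hJ, hx, hl, hg', hlt⟩ :=
        good_step cs hg hsJ hdes
      obtain ⟨m, E, hE⟩ := ih (cs.length x') (hn ▸ hlt) x' L rfl hg'
      obtain ⟨E', -, hE'⟩ := extend cs E hE hkL hfin hwL hwK hs hJ hx hl
      exact ⟨m + 1, E', hE'⟩
    · have hno : ∀ s, cs.length (x * cs.simple s) < cs.length x → s ∈ J := by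
        intro s hs
        by_contra hsJ
        exact hd ⟨s, hsJ, hs⟩
      obtain ⟨hIJ, hlong⟩ := good_base cs hg hno
      exact ⟨0,
        { Lset := fun _ => I
          letter := fun _ => b
          tletter := fun _ => b
          wL := fun _ => x
          wK := fun _ => x
          x := fun _ => x
          hL0 := rfl
          hLm := hIJ
          hwL := fun _ _ => hlong
          hmem := by intros; omega
          hfinK := by intros; omega
          hwK := by intros; omega
          ht := by intros; omega
          hLi := by intros; omega
          hx0 := rfl
          hx := by intros; omega
          hred := by intros; omega }, rfl⟩

theorem good_of_core (cs : CoxeterSystem M W) {I J : Set B} {y pbar : W}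
    (hcore : IsCore cs I y J) (hmax : IsMaxOf cs (dcos cs I y J) pbar) : Good cs I pbar J := by
  obtain ⟨h1, h2⟩ := hcore
  have hc : ∀ u, u ∈ par cs J ↔ y * u * y⁻¹ ∈ par cs I := by
    intro u
    constructor
    · intro hu
      have : y * u ∈ lcos cs I y := by rw [h1, h2]; exact ⟨u, hu, rfl⟩
      obtain ⟨a, ha, he⟩ := this
      rw [he, mul_inv_cancel_right]; exact ha
    · intro hu
      have : y * u * y⁻¹ * y ∈ rcos cs y J := by rw [← h2, ← h1]; exact ⟨_, hu, rfl⟩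
      obtain ⟨b, hb, he⟩ := this
      rw [inv_mul_cancel_right] at he
      rw [mul_left_cancel he]; exact hb
  obtain ⟨hp, hm⟩ := hmax
  constructor
  · have hp2 := hp
    rw [h2] at hp2
    obtain ⟨b, hb, rfl⟩ := hp2
    intro u
    have e : y * b * u * (y * b)⁻¹ = y * (b * u * b⁻¹) * y⁻¹ := by group
    rw [e, ← hc]
    constructor
    · intro hu
      exact (par cs J).mul_mem ((par cs J).mul_mem hb hu) ((par cs J).inv_mem hb)
    · intro hu
      have h2 := (par cs J).mul_mem ((par cs J).mul_mem ((par cs J).inv_mem hb) hu) hb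
      have e3 : b⁻¹ * (b * u * b⁻¹) * b = u := by group
      rwa [e3] at h2
  · intro j hj
    obtain ⟨a, ha, b, hb, rfl⟩ := hp
    have h3 := hm (a * y * b * cs.simple j)
      ⟨a, ha, b * cs.simple j, (par cs J).mul_mem hb (simple_mem_par cs hj), by
        simp only [mul_assoc]⟩
    have h4 := cs.length_mul_simple_ne (a * y * b) j
    omega

theorem statement_7 (cs : CoxeterSystem M W) (I J : Set B)
    (hI : Finitary cs I) (hJ : Finitary cs J)
    (y pbar : W) (hcore : IsCore cs I y J)
    (hmax : IsMaxOf cs (dcos cs I y J) pbar)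
    (s : B) (hsJ : s ∉ J)
    (hdes : cs.length (pbar * cs.simple s) < cs.length pbar) :
    ∃ m : ℕ, 1 ≤ m ∧ ∃ E : RAtomExpr cs I J m, E.tletter m = s ∧ E.x m = pbar := by
  have hg := good_of_core cs hcore hmax
  obtain ⟨L, k, wL, wK, x', hkL, hfin, hwL, hwK, hs, hJ', hx, hl, hg', hlt⟩ :=
    good_step cs hg hsJ hdes
  obtain ⟨m, E, hE⟩ := exists_expr cs s I (cs.length x') x' L rfl hg'
  obtain ⟨E', hE', hE''⟩ := extend cs E hE hkL hfin hwL hwK hs hJ' hx hl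
  exact ⟨m + 1, by omega, E', hE', hE''⟩

end CoxeterAtoms
end

section
/- Let p be a core (I,J)-coset and let K ⊆ S be finitary with I ⊆ K. Then W_K·p̲·W_J = W_K·p̲ as subsets of W; moreover, if y denotes the minimal-length element of W_K·p̲, then y·W_J·y⁻¹ ⊆ W_K, the set L := K ∩ y·J·y⁻¹ satisfies W_L = y·W_J·y⁻¹, and |L| = |J|. -/
namespace CoxeterAtoms

variable {B : Type*} {W : Type*} [Group W] {M : CoxeterMatrix B}

open Polynomial.Chebyshev in
theorem aux_refl_pow {V : Type*} [AddCommGroup V] [Module ℝ V] {x y : V}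
    {f g : Module.Dual ℝ V} (hf : f x = 2) (hg : g y = 2) (m : ℕ) (hm : m ≠ 1)
    (h1 : f y = -2 * Real.cos (Real.pi / m)) (h2 : g x = -2 * Real.cos (Real.pi / m)) :
    (Module.reflection hf * Module.reflection hg) ^ m = 1 := by
  ext z
  rcases Nat.lt_or_ge m 3 with hlt | hge
  · interval_cases m
    · simp
    · exact absurd rfl hm
    · have h1' : f y = 0 := by rw [h1]; simp
      have h2' : g x = 0 := by rw [h2]; simp
      simp only [pow_two, LinearEquiv.mul_apply, Module.reflection_apply, map_sub, map_smul, hf, hg,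
        h1', h2', LinearEquiv.coe_one, id]
      module
  · have hm0 : (m : ℝ) ≠ 0 := by positivity
    have hm3 : (3 : ℝ) ≤ m := by exact_mod_cast hge
    set θ : ℝ := 2 * (Real.pi / m) with hθ
    have hmθ : m * θ = 2 * Real.pi := by rw [hθ]; field_simp
    have hsin : Real.sin θ ≠ 0 := by
      apply ne_of_gt
      apply Real.sin_pos_of_pos_of_lt_pi
      · rw [hθ]; positivity
      · nlinarith [Real.pi_pos]
    have ht : 2 * Real.cos θ = f y * g x - 2 := by
      rw [h1, h2, hθ, Real.cos_two_mul]; ring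
    have key : ∀ n : ℤ, (S ℝ n).eval (2 * Real.cos θ) = Real.sin ((n + 1) * θ) / Real.sin θ := by
      intro n
      rw [eq_div_iff hsin]
      exact S_two_mul_real_cos θ n
    rw [Module.reflection_mul_reflection_pow_apply hf hg m z (2 * Real.cos θ) ht]
    rcases Nat.even_or_odd' m with ⟨k, hk | hk⟩
    · have e1 : ((m : ℤ) - 2) / 2 = k - 1 := by omega
      have e2 : ((m : ℤ) - 1) / 2 = k - 1 := by omega
      have e3 : (S ℝ ((k : ℤ) - 1)).eval (2 * Real.cos θ) = 0 := by
        rw [key]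
        have : (((k : ℤ) - 1 : ℤ) + 1 : ℝ) * θ = Real.pi := by
          rw [hk] at hmθ
          push_cast at hmθ ⊢
          linarith
        rw [this]; simp
      rw [e1, e2, e3]; simp
    · have e1 : ((m : ℤ) - 2) / 2 = k - 1 := by omega
      have e2 : ((m : ℤ) - 1) / 2 = k := by omega
      have e4 : ((m : ℤ) - 3) / 2 = k - 1 := by omega
      have e5 : (m : ℤ) / 2 = k := by omega
      have e3 : (S ℝ (k : ℤ)).eval (2 * Real.cos θ)
          + (S ℝ ((k : ℤ) - 1)).eval (2 * Real.cos θ) = 0 := by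
        rw [key, key, ← add_div]
        have : (((k : ℤ) - 1 : ℤ) + 1 : ℝ) * θ = 2 * Real.pi - (((k : ℤ) : ℝ) + 1) * θ := by
          rw [hk] at hmθ
          push_cast at hmθ ⊢
          linarith
        rw [this, Real.sin_two_pi_sub]; simp
      rw [e1, e2, e4, e5, e3]; simp

theorem aux_simple_injective (cs : CoxeterSystem M W) : Function.Injective cs.simple := by
  classical
  let c : B → Module.Dual ℝ (B →₀ ℝ) := fun i =>
    Finsupp.linearCombination ℝ (fun j => -2 * Real.cos (Real.pi / M i j))
  have hc : ∀ i j, c i (Finsupp.single j 1) = -2 * Real.cos (Real.pi / M i j) := by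
    intro i j
    simp [c]
  have hcc : ∀ i, c i (Finsupp.single i 1) = 2 := by
    intro i
    rw [hc, M.diagonal]; simp
  let r : B → ((B →₀ ℝ) ≃ₗ[ℝ] (B →₀ ℝ)) := fun i => Module.reflection (hcc i)
  have hr : M.IsLiftable r := by
    intro i j
    by_cases hij : i = j
    · subst hij
      rw [M.diagonal, pow_one]
      ext1 z
      exact Module.involutive_reflection (hcc i) z
    · refine aux_refl_pow (hcc i) (hcc j) _ (M.off_diagonal i j hij) (hc i j) ?_
      rw [hc, M.symmetric]
  intro i j hij
  by_contra hne
  have h1 : r i = r j := by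
    rw [← cs.lift_apply_simple hr i, ← cs.lift_apply_simple hr j, hij]
  have h2 : r i (Finsupp.single i 1) i = r j (Finsupp.single i 1) i := by rw [h1]
  simp only [r, Module.reflection_apply, hcc, hc] at h2
  simp [Ne.symm hne] at h2

open Classical in
/-- The generator of the action on `W × ZMod 2`. -/
noncomputable def auxAct (cs : CoxeterSystem M W) (i : B) : Function.End (W × ZMod 2) :=
  fun p => (cs.simple i * p.1 * cs.simple i, p.2 + if p.1 = cs.simple i then 1 else 0)

open Classical in
theorem aux_act_pow (cs : CoxeterSystem M W) (i j : B) (n : ℕ) (t : W) (e : ZMod 2) :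
    ((auxAct cs i * auxAct cs j) ^ n) (t, e) =
      ((cs.simple i * cs.simple j) ^ n * t * ((cs.simple i * cs.simple j) ^ n)⁻¹,
        e + ∑ k ∈ Finset.range (2 * n),
          if t = cs.simple j * (cs.simple i * cs.simple j) ^ k then 1 else 0) := by
  induction n with
  | zero => simp; rfl
  | succ n ih =>
    rw [pow_succ']
    change (auxAct cs i) ((auxAct cs j) (((auxAct cs i * auxAct cs j) ^ n) (t, e))) = _
    rw [ih]
    have hji : cs.simple j * cs.simple i = (cs.simple i * cs.simple j)⁻¹ := by simp
    set r := cs.simple i * cs.simple j with hr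
    have hconj : ∀ k : ℕ, r ^ k * cs.simple j * r ^ k = cs.simple j := by
      intro k
      induction k with
      | zero => simp
      | succ k ihk =>
        have h : r * cs.simple j * r = cs.simple j := by
          rw [hr]; simp [mul_assoc]
        calc r ^ (k + 1) * cs.simple j * r ^ (k + 1)
            = r ^ k * (r * cs.simple j * r) * r ^ k := by
              rw [pow_succ r k, mul_assoc (r ^ k) r, ← pow_succ, pow_succ' r k]; simp only [mul_assoc]
          _ = cs.simple j := by rw [h, ihk]
    have hg : ∀ n m : ℕ, r ^ n * (cs.simple j * r ^ (2 * n + m)) = cs.simple j * r ^ (n + m) := by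
      intro n m
      rw [show 2 * n + m = n + (n + m) by ring, pow_add r n (n + m)]
      simp only [← mul_assoc]
      rw [hconj]
    have hc1 : (r ^ n * t * (r ^ n)⁻¹ = cs.simple j) ↔ t = cs.simple j * r ^ (2 * n) := by
      rw [mul_inv_eq_iff_eq_mul]
      have := hg n 0
      simp only [add_zero] at this
      rw [← this, mul_right_inj]
    have hc2 : (cs.simple j * (r ^ n * t * (r ^ n)⁻¹) * cs.simple j = cs.simple i) ↔
        t = cs.simple j * r ^ (2 * n + 1) := by
      have h2 : (r ^ n * t * (r ^ n)⁻¹ = cs.simple j * r) ↔ t = cs.simple j * r ^ (2 * n + 1) := by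
        rw [mul_inv_eq_iff_eq_mul, mul_assoc (cs.simple j), ← pow_succ', ← hg n 1, mul_right_inj]
      rw [← h2]
      generalize r ^ n * t * (r ^ n)⁻¹ = X
      rw [hr]
      constructor
      · intro h
        rw [← h]; simp [mul_assoc]
      · intro h
        rw [h]; simp [mul_assoc]
    simp only [auxAct, hc1, hc2]
    ext1
    · simp only
      rw [pow_succ']
      simp [hr, mul_assoc]
    · simp only
      rw [show 2 * (n + 1) = 2 * n + 1 + 1 by ring, Finset.sum_range_succ, Finset.sum_range_succ]
      ring

theorem aux_act_liftable (cs : CoxeterSystem M W) : M.IsLiftable (auxAct cs) := by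
  classical
  intro i j
  funext p
  obtain ⟨t, e⟩ := p
  rw [aux_act_pow, cs.simple_mul_simple_pow, two_mul, Finset.sum_range_add]
  have h : ∀ k, cs.simple j * (cs.simple i * cs.simple j) ^ (M i j + k)
      = cs.simple j * (cs.simple i * cs.simple j) ^ k := by
    intro k
    rw [pow_add, cs.simple_mul_simple_pow, one_mul]
  simp only [h, CharTwo.add_self_eq_zero]
  simp
  rfl

/-- The action of `W` on `W × ZMod 2`. -/
noncomputable def auxRep (cs : CoxeterSystem M W) : W →* Function.End (W × ZMod 2) :=
  cs.lift ⟨auxAct cs, aux_act_liftable cs⟩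

open Classical in
theorem auxRep_wordProd (cs : CoxeterSystem M W) (ω : List B) (t : W) :
    auxRep cs (cs.wordProd ω) (t, 0) =
      (cs.wordProd ω * t * (cs.wordProd ω)⁻¹, (((cs.rightInvSeq ω).count t : ℕ) : ZMod 2)) := by
  induction ω with
  | nil => simp; rfl
  | cons i ω ih =>
    rw [cs.wordProd_cons, map_mul]
    change auxRep cs (cs.simple i) (auxRep cs (cs.wordProd ω) (t, 0)) = _
    rw [ih]
    have : auxRep cs (cs.simple i) = auxAct cs i := cs.lift_apply_simple (aux_act_liftable cs) i
    rw [this]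
    have hiff : (cs.wordProd ω * t * (cs.wordProd ω)⁻¹ = cs.simple i) ↔
        ((cs.wordProd ω)⁻¹ * cs.simple i * cs.wordProd ω = t) := by
      constructor
      · intro h
        rw [← h]; group
      · intro h
        rw [← h]; group
    simp only [auxAct, CoxeterSystem.rightInvSeq, List.count_cons, beq_iff_eq, hiff]
    ext1
    · simp [mul_assoc]
    · simp

open Classical in
theorem aux_count_mod (cs : CoxeterSystem M W) (ω ω' : List B)
    (h : cs.wordProd ω = cs.wordProd ω') (t : W) :
    (((cs.rightInvSeq ω).count t : ℕ) : ZMod 2) = (((cs.rightInvSeq ω').count t : ℕ) : ZMod 2) := by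
  have h1 := auxRep_wordProd cs ω t
  have h2 := auxRep_wordProd cs ω' t
  rw [h, h2] at h1
  exact (congrArg Prod.snd h1).symm

/-- Exchange condition (right). -/
theorem aux_exchange_right (cs : CoxeterSystem M W) (ω : List B) (i : B)
    (h : cs.length (cs.wordProd ω * cs.simple i) < cs.length (cs.wordProd ω)) :
    cs.simple i ∈ cs.rightInvSeq ω := by
  classical
  obtain ⟨ω', hred, hω'⟩ := cs.exists_isReduced (cs.wordProd ω * cs.simple i)
  have hw : cs.wordProd ω = cs.wordProd (ω'.concat i) := by
    rw [cs.wordProd_concat, ← hω']; simp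
  have hnot : cs.simple i ∉ cs.rightInvSeq ω' := by
    intro hm
    have := (cs.isRightInversion_of_mem_rightInvSeq hred hm).2
    rw [← hω'] at this
    simp at this
    omega
  have hc := aux_count_mod cs _ _ hw (cs.simple i)
  rw [cs.rightInvSeq_concat, List.concat_eq_append, List.count_append] at hc
  have hz : (List.map (MulAut.conj (cs.simple i)) (cs.rightInvSeq ω')).count (cs.simple i) = 0 := by
    rw [List.count_eq_zero]
    intro hm
    obtain ⟨t, ht, hte⟩ := List.mem_map.mp hm
    apply hnot
    have : t = cs.simple i := by
      rw [MulAut.conj_apply] at hte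
      have h3 := congrArg (fun z => cs.simple i * z * cs.simple i) hte
      simpa [mul_assoc] using h3
    rwa [← this]
  rw [hz] at hc
  by_contra hcon
  rw [List.count_eq_zero.mpr hcon] at hc
  simp at hc

/-- Exchange condition (left). -/
theorem aux_exchange_left (cs : CoxeterSystem M W) (ω : List B) (i : B)
    (h : cs.length (cs.simple i * cs.wordProd ω) < cs.length (cs.wordProd ω)) :
    ∃ j < ω.length, cs.simple i * cs.wordProd ω = cs.wordProd (ω.eraseIdx j) := by
  have h1 : cs.simple i ∈ cs.rightInvSeq ω.reverse := by
    apply aux_exchange_right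
    rw [cs.wordProd_reverse, cs.length_inv, ← cs.length_inv]
    simpa using h
  rw [cs.rightInvSeq_reverse, List.mem_reverse] at h1
  obtain ⟨j, hj, hji⟩ := List.mem_iff_getElem.mp h1
  refine ⟨j, by simpa using hj, ?_⟩
  rw [← cs.getD_leftInvSeq_mul_wordProd, List.getD_eq_getElem _ 1 hj, hji]

theorem aux_wordProd_mem (cs : CoxeterSystem M W) (K : Set B) (κ : List B) (h : ∀ k ∈ κ, k ∈ K) :
    cs.wordProd κ ∈ par cs K := by
  induction κ with
  | nil => simp [one_mem]
  | cons i κ ih =>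
    rw [cs.wordProd_cons]
    exact mul_mem (Subgroup.subset_closure ⟨i, h i (by simp), rfl⟩)
      (ih fun k hk => h k (by simp [hk]))

theorem aux_exists_word (cs : CoxeterSystem M W) (K : Set B) (a : W) (ha : a ∈ par cs K) :
    ∃ κ : List B, (∀ k ∈ κ, k ∈ K) ∧ cs.wordProd κ = a := by
  unfold par at ha
  induction ha using Subgroup.closure_induction with
  | mem x hx =>
    obtain ⟨i, hi, rfl⟩ := hx
    exact ⟨[i], by simpa using hi, by simp⟩
  | one => exact ⟨[], by simp, by simp⟩
  | mul x y _ _ hx hy =>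
    obtain ⟨κ, h1, rfl⟩ := hx
    obtain ⟨κ', h2, rfl⟩ := hy
    refine ⟨κ ++ κ', ?_, cs.wordProd_append _ _⟩
    intro k hk
    rcases List.mem_append.mp hk with h | h
    · exact h1 k h
    · exact h2 k h
  | inv x _ hx =>
    obtain ⟨κ, h1, rfl⟩ := hx
    exact ⟨κ.reverse, by simpa using h1, cs.wordProd_reverse _⟩

theorem aux_length_add (cs : CoxeterSystem M W) (K : Set B) (y : W)
    (hy : ∀ a ∈ par cs K, cs.length y ≤ cs.length (a * y)) (κ : List B) (hκ : ∀ k ∈ κ, k ∈ K)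
    (hmin : ∀ κ' : List B, (∀ k ∈ κ', k ∈ K) → cs.wordProd κ' = cs.wordProd κ →
      κ.length ≤ κ'.length) :
    cs.length (cs.wordProd κ * y) = κ.length + cs.length y := by
  induction κ with
  | nil => simp
  | cons i κ ih =>
    have hiK : i ∈ K := hκ i (by simp)
    have hκ' : ∀ k ∈ κ, k ∈ K := fun k hk => hκ k (by simp [hk])
    have ih' := ih hκ' (by
      intro κ' h1 h2
      have := hmin (i :: κ') (by simpa using ⟨hiK, h1⟩) (by rw [cs.wordProd_cons, cs.wordProd_cons, h2])
      simpa using this)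
    rw [cs.wordProd_cons, mul_assoc]
    rcases cs.length_simple_mul (cs.wordProd κ * y) i with h | h
    · rw [h, ih', List.length_cons]; ring
    · exfalso
      obtain ⟨η, hη, hyη⟩ := cs.exists_isReduced y
      have hw : cs.wordProd κ * y = cs.wordProd (κ ++ η) := by rw [cs.wordProd_append, ← hyη]
      obtain ⟨j, hj, he⟩ := aux_exchange_left cs (κ ++ η) i (by rw [← hw]; omega)
      rw [← hw] at he
      rcases Nat.lt_or_ge j κ.length with hlt | hge
      · rw [List.eraseIdx_append_of_lt_length hlt, cs.wordProd_append, ← hyη, ← mul_assoc,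
          mul_left_inj] at he
        have := hmin (κ.eraseIdx j) (fun k hk => hκ' k (List.mem_of_mem_eraseIdx hk))
          (by rw [cs.wordProd_cons, he])
        rw [List.length_eraseIdx_of_lt hlt, List.length_cons] at this
        omega
      · rw [List.eraseIdx_append_of_length_le hge, cs.wordProd_append] at he
        have hmem : (cs.wordProd κ)⁻¹ * (cs.simple i * cs.wordProd κ) ∈ par cs K := by
          have := aux_wordProd_mem cs K κ hκ'
          exact mul_mem (inv_mem this) (mul_mem (Subgroup.subset_closure ⟨i, hiK, rfl⟩) this)
        have h1 := hy _ hmem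
        have h2 : (cs.wordProd κ)⁻¹ * (cs.simple i * cs.wordProd κ) * y
            = cs.wordProd (η.eraseIdx (j - κ.length)) := by
          rw [mul_assoc, mul_assoc, he]; simp
        rw [h2] at h1
        have h3 := cs.length_wordProd_le (η.eraseIdx (j - κ.length))
        rw [List.length_append] at hj
        rw [List.length_eraseIdx_of_lt (by omega)] at h3
        rw [hyη, hη.eq] at h1
        omega

theorem aux_conj_simple (cs : CoxeterSystem M W) (K : Set B) (y : W)
    (hy : ∀ a ∈ par cs K, cs.length y ≤ cs.length (a * y)) (j : B)
    (hj : y * cs.simple j * y⁻¹ ∈ par cs K) :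
    ∃ k ∈ K, cs.simple k = y * cs.simple j * y⁻¹ := by
  classical
  have hex : ∃ n, ∃ κ : List B, κ.length = n ∧ (∀ k ∈ κ, k ∈ K) ∧
      cs.wordProd κ = y * cs.simple j * y⁻¹ := by
    obtain ⟨κ, h⟩ := aux_exists_word cs K _ hj
    exact ⟨_, κ, rfl, h⟩
  obtain ⟨κ, hlen, hκ, hp⟩ := Nat.find_spec hex
  have hl := aux_length_add cs K y hy κ hκ (by
    intro κ' h1 h2
    rw [hlen]
    exact Nat.find_min' hex ⟨κ', rfl, h1, h2.trans hp⟩)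
  rw [hp, inv_mul_cancel_right] at hl
  have h1 := cs.length_mul_le y (cs.simple j)
  rw [cs.length_simple] at h1
  match κ, hκ, hp, hl with
  | [], _, hp, hl =>
    exact absurd (by simpa using hl) (cs.length_mul_simple_ne y j)
  | [k], hκ, hp, _ => exact ⟨k, hκ k (by simp), by simpa using hp⟩
  | _ :: _ :: _, _, _, hl =>
    simp only [List.length_cons] at hl
    omega

theorem statement_10 (cs : CoxeterSystem M W) (I J K : Set B)
    (hI : Finitary cs I) (hJ : Finitary cs J) (hK : Finitary cs K) (hIK : I ⊆ K)
    (pm : W) (hpmin : IsMinRep cs I pm J) (hpcore : IsCore cs I pm J)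
    (y : W) (hy : y ∈ lcos cs K pm)
    (hymin : ∀ w ∈ lcos cs K pm, cs.length y ≤ cs.length w) :
    dcos cs K pm J = lcos cs K pm ∧
    (∀ b ∈ par cs J, y * b * y⁻¹ ∈ par cs K) ∧
    ((par cs {k ∈ K | ∃ j ∈ J, cs.simple k = y * cs.simple j * y⁻¹} : Set W) =
      (fun b => y * b * y⁻¹) '' (par cs J : Set W)) ∧
    ({k ∈ K | ∃ j ∈ J, cs.simple k = y * cs.simple j * y⁻¹} : Set B).ncard = J.ncard := by
  have hL : ∀ a ∈ par cs I, a ∈ par cs K := by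
    intro a ha
    exact Subgroup.closure_mono (Set.image_mono hIK) ha
  have hconj : ∀ b ∈ par cs J, ∃ a ∈ par cs I, pm * b = a * pm := by
    intro b hb
    have h1 : pm * b ∈ lcos cs I pm := by
      rw [hpcore.1]
      exact ⟨1, one_mem _, b, hb, by simp⟩
    exact h1
  obtain ⟨c, hc, hyc⟩ := hy
  have hconjy : ∀ b ∈ par cs J, y * b * y⁻¹ ∈ par cs K := by
    intro b hb
    obtain ⟨a, ha, hab⟩ := hconj b hb
    have : y * b * y⁻¹ = c * a * c⁻¹ := by
      rw [hyc, mul_assoc c, hab]; group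
    rw [this]
    exact mul_mem (mul_mem hc (hL a ha)) (inv_mem hc)
  have hymin' : ∀ a ∈ par cs K, cs.length y ≤ cs.length (a * y) := by
    intro a ha
    exact hymin _ ⟨a * c, mul_mem ha hc, by rw [hyc, mul_assoc]⟩
  have hsimp : ∀ j ∈ J, ∃ k ∈ K, cs.simple k = y * cs.simple j * y⁻¹ := by
    intro j hj
    exact aux_conj_simple cs K y hymin' j (hconjy _ (Subgroup.subset_closure ⟨j, hj, rfl⟩))
  have hinj := aux_simple_injective cs
  refine ⟨?_, hconjy, ?_, ?_⟩
  · ext w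
    constructor
    · rintro ⟨a, ha, b, hb, rfl⟩
      obtain ⟨a', ha', hab⟩ := hconj b hb
      exact ⟨a * a', mul_mem ha (hL _ ha'), by rw [mul_assoc, hab, mul_assoc]⟩
    · rintro ⟨a, ha, rfl⟩
      exact ⟨a, ha, 1, one_mem _, by simp⟩
  · have himg : cs.simple '' {k ∈ K | ∃ j ∈ J, cs.simple k = y * cs.simple j * y⁻¹} =
        (MulAut.conj y).toMonoidHom '' (cs.simple '' J) := by
      ext w
      constructor
      · rintro ⟨k, ⟨_, j, hj, h⟩, rfl⟩
        exact ⟨cs.simple j, ⟨j, hj, rfl⟩, by simp [h]⟩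
      · rintro ⟨_, ⟨j, hj, rfl⟩, rfl⟩
        obtain ⟨k, hk, h⟩ := hsimp j hj
        exact ⟨k, ⟨hk, j, hj, h⟩, by simp [h]⟩
    unfold par
    rw [himg, ← MonoidHom.map_closure]
    rfl
  · symm
    choose! f hfK hf using hsimp
    refine Set.ncard_congr (fun j _ => f j) ?_ ?_ ?_
    · intro j hj
      exact ⟨hfK j hj, j, hj, hf j hj⟩
    · intro i j hi hj hij
      have h := hf i hi
      rw [show f i = f j from hij, hf j hj] at h
      apply hinj
      simpa using h.symm
    · rintro k ⟨_, j, hj, h⟩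
      exact ⟨j, hj, hinj ((hf j hj).trans h.symm)⟩

end CoxeterAtoms
end
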